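/- For every m ∈ ℂ there exists an Umemura polynomial sequence with parameter m; that is, there exists a sequence of nonzero polynomials s₋₁, s₀, s₁, s₂, … over ℂ with s₋₁ = s₀ = 1 such that for all n ≥ 0 the recurrence 2·s_{n−1}·s_{n+1} = (4X + 2m + 1)·s_n² − s_n·s_n′ − X·(s_n·s_n″ − (s_n′)²) holds in the polynomial ring ℂ[X] (in particular, the right-hand side is always divisible by 2·s_{n−1}). -/

import Mathlib

open Complex Polynomial

/-- `s` (indexed over `ℤ`, relevant indices `n ≥ -1`) is an Umemura polynomial
sequence with parameter `m`: all terms of index `≥ -1` are nonzero polynomials,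
`s₋₁ = s₀ = 1`, and the Umemura recurrence holds for all `n ≥ 0`. -/
def IsUmemuraSeq (m : ℂ) (s : ℤ → Polynomial ℂ) : Prop :=
  (∀ n : ℤ, -1 ≤ n → s n ≠ 0) ∧ s (-1) = 1 ∧ s 0 = 1 ∧
  ∀ n : ℤ, 0 ≤ n →
    2 * s (n - 1) * s (n + 1) =
      (4 * Polynomial.X + Polynomial.C (2 * m + 1)) * (s n) ^ 2
        - s n * Polynomial.derivative (s n)
        - Polynomial.X *
            (s n * Polynomial.derivative (Polynomial.derivative (s n))
              - (Polynomial.derivative (s n)) ^ 2)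

/-- The right-hand side of the Umemura recurrence, for a derivation `D` of a commutative ring and
arbitrary coefficients `x` and `a`. -/
def umemuraForm {A : Type*} [CommRing A] [Algebra ℂ A] (D : Derivation ℂ A A) (x a f : A) : A :=
  a * f ^ 2 - f * D f - x * (f * D (D f) - D f ^ 2)

section Divisibility

variable {A : Type*} [CommRing A] [Algebra ℂ A] {D : Derivation ℂ A A} {x a : A}

lemma derivation_two (D : Derivation ℂ A A) : D 2 = 0 := by
  exact_mod_cast D.map_natCast 2

lemma derivation_sq (D : Derivation ℂ A A) (f : A) : D (f ^ 2) = 2 * f * D f := by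
  rw [sq, D.leibniz, smul_eq_mul]; ring

lemma derivation_umemuraForm (hx : D x = 1) (f : A) :
    D (umemuraForm D x a f) =
      x * D f * D (D f) + f * (D a * f + 2 * a * D f - 2 * D (D f) - x * D (D (D f))) := by
  simp only [umemuraForm, map_sub, D.leibniz, derivation_sq, smul_eq_mul, hx]
  ring

lemma derivation_derivation_umemuraForm (hx : D x = 1) (f : A) :
    D (D (umemuraForm D x a f)) =
      2 * a * D f ^ 2 - D f * D (D f) + x * D (D f) ^ 2 +
        f * (D (D a) * f + 4 * D a * D f + 2 * a * D (D f) - 3 * D (D (D f))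
          - x * D (D (D (D f)))) := by
  rw [derivation_umemuraForm hx]
  simp only [map_add, map_sub, D.leibniz, derivation_two, smul_eq_mul, hx]
  ring

/-- Applying the Umemura form twice gives, up to a multiple of `f`, twice the leading term. -/
lemma dvd_umemuraForm_umemuraForm (hx : D x = 1) (f : A) :
    f ∣ a * umemuraForm D x a f ^ 2 + umemuraForm D x a (umemuraForm D x a f) := by
  have h0 : umemuraForm D x a f = x * D f ^ 2 + f * (a * f - D f - x * D (D f)) := by
    simp only [umemuraForm]; ring
  have h1 := derivation_umemuraForm (a := a) hx f
  have h2 := derivation_derivation_umemuraForm (a := a) hx f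
  generalize umemuraForm D x a f = R at h0 h1 h2 ⊢
  rw [umemuraForm, h2, h1, h0]
  generalize a * f - D f - x * D (D f) = r0
  generalize D a * f + 2 * a * D f - 2 * D (D f) - x * D (D (D f)) = r1
  generalize D (D a) * f + 4 * D a * D f + 2 * a * D (D f) - 3 * D (D (D f))
    - x * D (D (D (D f))) = r2
  generalize D (D f) = f2
  generalize D f = f1
  refine ⟨4 * a * x * f1 ^ 2 * r0 + 2 * a * f * r0 ^ 2
    - (x * f1 ^ 2 * r1 + x * f1 * f2 * r0 + f * r0 * r1)
    - x * (x * f1 ^ 2 * r2 + r0 * (2 * a * f1 ^ 2 - f1 * f2 + x * f2 ^ 2) + f * r0 * r2)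
    + 2 * x ^ 2 * f1 * f2 * r1 + x * f * r1 ^ 2, ?_⟩
  ring

lemma umemuraForm_two_mul_mul (g h : A) :
    a * (2 * g * h) ^ 2 + umemuraForm D x a (2 * g * h) =
      4 * g ^ 2 * umemuraForm D x a h + 4 * h ^ 2 * umemuraForm D x a g := by
  simp only [umemuraForm, map_add, D.leibniz, derivation_two, smul_eq_mul, mul_zero, add_zero]
  ring

lemma dvd_mul_umemuraForm (hx : D x = 1) {f g h : A} (hgh : 2 * g * h = umemuraForm D x a f)
    (hf : f ∣ umemuraForm D x a g) : f ∣ 4 * g ^ 2 * umemuraForm D x a h := by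
  have key := dvd_umemuraForm_umemuraForm (a := a) hx f
  rw [← hgh, umemuraForm_two_mul_mul] at key
  exact (dvd_add_left (hf.mul_left _)).1 key

lemma umemuraForm_map {B : Type*} [CommRing B] [Algebra ℂ B] {D' : Derivation ℂ B B}
    (φ : A →ₐ[ℂ] B) (hφ : ∀ p, φ (D p) = D' (φ p)) (f : A) :
    φ (umemuraForm D x a f) = umemuraForm D' (φ x) (φ a) (φ f) := by
  simp only [umemuraForm, map_sub, map_mul, map_pow, hφ]

end Divisibility

section Generic

/-- The derivation of `ℂ[X₀, X₁, X₂, …]` for which `X₀` is the independent variable and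
`X₁, X₂, …` are the successive derivatives of a differential indeterminate `X₁`. -/
noncomputable def jetDerivation : Derivation ℂ (MvPolynomial ℕ ℂ) (MvPolynomial ℕ ℂ) :=
  MvPolynomial.mkDerivation ℂ fun i => if i = 0 then 1 else MvPolynomial.X (i + 1)

lemma jetDerivation_X_zero : jetDerivation (MvPolynomial.X 0) = 1 := by
  simp [jetDerivation]

lemma jetDerivation_X_succ (i : ℕ) :
    jetDerivation (MvPolynomial.X (i + 1)) = MvPolynomial.X (i + 2) := by
  simp [jetDerivation]

/-- The Umemura form with generic coefficient `X₁`. -/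
noncomputable abbrev jetForm (f : MvPolynomial ℕ ℂ) : MvPolynomial ℕ ℂ :=
  umemuraForm jetDerivation (MvPolynomial.X 0) (MvPolynomial.X 1) f

/-- Specialization of the differential indeterminate to a polynomial `a`. -/
noncomputable def jetEval (a : ℂ[X]) : MvPolynomial ℕ ℂ →ₐ[ℂ] ℂ[X] :=
  MvPolynomial.aeval fun i => if i = 0 then X else derivative^[i - 1] a

lemma jetEval_X_zero (a : ℂ[X]) : jetEval a (MvPolynomial.X 0) = X := by
  simp [jetEval]

lemma jetEval_X_succ (a : ℂ[X]) (i : ℕ) :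
    jetEval a (MvPolynomial.X (i + 1)) = derivative^[i] a := by
  simp [jetEval]

lemma jetEval_X_one (a : ℂ[X]) : jetEval a (MvPolynomial.X 1) = a :=
  jetEval_X_succ a 0

lemma jetEval_jetDerivation (a : ℂ[X]) (p : MvPolynomial ℕ ℂ) :
    jetEval a (jetDerivation p) = derivative' (jetEval a p) := by
  induction p using MvPolynomial.induction_on with
  | C c => simp [jetEval, MvPolynomial.derivation_C, MvPolynomial.algHom_C]
  | add p q hp hq => simp only [map_add, hp, hq]
  | mul_X p i hp =>
    have hX : jetEval a (jetDerivation (MvPolynomial.X i)) =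
        derivative' (jetEval a (MvPolynomial.X i)) := by
      cases i with
      | zero => simp [jetDerivation_X_zero, jetEval_X_zero]
      | succ i =>
        rw [jetDerivation_X_succ, jetEval_X_succ, jetEval_X_succ, Function.iterate_succ_apply']
        rfl
    simp only [Derivation.leibniz, map_mul, map_add, smul_eq_mul, hp, hX]

lemma jetEval_jetForm (a : ℂ[X]) (f : MvPolynomial ℕ ℂ) :
    jetEval a (jetForm f) = umemuraForm derivative' X a (jetEval a f) := by
  rw [jetForm, umemuraForm_map (jetEval a) (jetEval_jetDerivation a), jetEval_X_zero,
    jetEval_X_one]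

lemma pderiv_jetDerivation (j : ℕ) (p : MvPolynomial ℕ ℂ) :
    MvPolynomial.pderiv (j + 2) (jetDerivation p) =
      jetDerivation (MvPolynomial.pderiv (j + 2) p) + MvPolynomial.pderiv (j + 1) p := by
  induction p using MvPolynomial.induction_on with
  | C c => simp [MvPolynomial.derivation_C]
  | add p q hp hq => simp only [map_add, hp, hq]; ring
  | mul_X p i hp =>
    have hX : MvPolynomial.pderiv (j + 2) (jetDerivation (MvPolynomial.X i)) =
        MvPolynomial.pderiv (j + 1) (MvPolynomial.X i : MvPolynomial ℕ ℂ) := by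
      cases i with
      | zero => simp [jetDerivation_X_zero]
      | succ i => simp [jetDerivation_X_succ, Pi.single_apply]
    have hX' : jetDerivation (MvPolynomial.pderiv (j + 2) (MvPolynomial.X i)) = 0 := by
      rw [MvPolynomial.pderiv_X, Pi.single_apply]
      split_ifs <;> simp
    simp only [Derivation.leibniz, map_add, smul_eq_mul, hp, hX, hX']
    ring

lemma pderiv_eq_zero_of_dvd {j : ℕ} {p f : MvPolynomial ℕ ℂ} (hf0 : f ≠ 0) (hpf : p ∣ f)
    (hf : MvPolynomial.pderiv j f = 0) : MvPolynomial.pderiv j p = 0 := by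
  obtain ⟨q, rfl⟩ := hpf
  have hdeg : (p * q).degreeOf j = 0 := by
    rw [← Nat.le_zero, MvPolynomial.degreeOf_le_iff]
    intro d hd
    by_contra! hlt
    refine MvPolynomial.mem_support_iff.1 hd ?_
    have hc := MvPolynomial.coeff_pderiv (i := j) (p * q) (d - Finsupp.single j 1)
    have hle : Finsupp.single j 1 ≤ d := by
      simpa [Nat.one_le_iff_ne_zero, Nat.pos_iff_ne_zero] using hlt
    rw [hf, MvPolynomial.coeff_zero, tsub_add_cancel_of_le hle] at hc
    exact (mul_eq_zero.1 hc.symm).resolve_right (Nat.cast_add_one_ne_zero _)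
  rw [MvPolynomial.degreeOf_mul_eq (left_ne_zero_of_mul hf0) (right_ne_zero_of_mul hf0)] at hdeg
  refine MvPolynomial.pderiv_eq_zero_of_notMem_vars fun hmem => ?_
  exact MvPolynomial.mem_vars_iff_degreeOf_ne_zero.1 hmem (by omega)

/-- The variable of index `j + 3` enters a term of the generic sequence only through the second
derivative of the preceding term. -/
lemma pderiv_of_two_mul_mul_eq_jetForm {g f h : MvPolynomial ℕ ℂ} {j : ℕ}
    (hgh : 2 * g * h = jetForm f) (hg : MvPolynomial.pderiv (j + 3) g = 0)
    (hf2 : MvPolynomial.pderiv (j + 2) f = 0) (hf3 : MvPolynomial.pderiv (j + 3) f = 0) :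
    2 * g * MvPolynomial.pderiv (j + 3) h =
      -(MvPolynomial.X 0 * f * MvPolynomial.pderiv (j + 1) f) := by
  have hD : MvPolynomial.pderiv (j + 3) (jetDerivation f) = 0 := by
    rw [pderiv_jetDerivation, hf3, hf2, map_zero, add_zero]
  have hDD : MvPolynomial.pderiv (j + 3) (jetDerivation (jetDerivation f)) =
      MvPolynomial.pderiv (j + 1) f := by
    rw [pderiv_jetDerivation, hD, pderiv_jetDerivation, hf2, map_zero, zero_add, zero_add]
  have hX0 : MvPolynomial.pderiv (j + 3) (MvPolynomial.X 0 : MvPolynomial ℕ ℂ) = 0 :=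
    MvPolynomial.pderiv_X_of_ne (by omega)
  have hX1 : MvPolynomial.pderiv (j + 3) (MvPolynomial.X 1 : MvPolynomial ℕ ℂ) = 0 :=
    MvPolynomial.pderiv_X_of_ne (by omega)
  have key := congrArg (MvPolynomial.pderiv (j + 3)) hgh
  simp only [jetForm, umemuraForm, map_sub, Derivation.leibniz, derivation_sq, derivation_two,
    smul_eq_mul, hg, hf3, hD, hDD, hX0, hX1] at key
  linear_combination key

/-- The invariant carried by consecutive terms `g`, `f` of the generic Umemura sequence. -/
structure JetPair (n : ℕ) (g f : MvPolynomial ℕ ℂ) : Prop where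
  dvd_left : f ∣ jetForm g
  dvd_right : g ∣ jetForm f
  isRelPrime : IsRelPrime g f
  eval_left : jetEval 2 g = 1
  eval_right : jetEval 2 f = 1
  pderiv_left : ∀ j, 2 * n < j → MvPolynomial.pderiv j g = 0
  pderiv_right : ∀ j, 2 * n + 1 < j → MvPolynomial.pderiv j f = 0
  pderiv_top : ∃ c : ℂ, c ≠ 0 ∧
    MvPolynomial.pderiv (2 * n + 1) f = MvPolynomial.C c * MvPolynomial.X 0 ^ n * g

lemma jetForm_one : jetForm 1 = MvPolynomial.X 1 := by
  simp [umemuraForm]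

lemma jetEval_two_jetForm {f : MvPolynomial ℕ ℂ} (hf : jetEval 2 f = 1) :
    jetEval 2 (jetForm f) = 2 := by
  rw [jetEval_jetForm, hf]
  simp [umemuraForm]

lemma JetPair.zero : JetPair 0 1 (MvPolynomial.C (1 / 2) * MvPolynomial.X 1) where
  dvd_left := by
    rw [jetForm_one]
    refine ⟨MvPolynomial.C 2, ?_⟩
    rw [mul_right_comm, ← MvPolynomial.C_mul]
    norm_num
  dvd_right := one_dvd _
  isRelPrime := isRelPrime_one_left
  eval_left := map_one _
  eval_right := by
    rw [map_mul, jetEval_X_one, jetEval, MvPolynomial.algHom_C, Polynomial.algebraMap_eq,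
      ← Polynomial.C_ofNat, ← Polynomial.C_mul]
    norm_num
  pderiv_left j _ := MvPolynomial.pderiv_one
  pderiv_right j hj := by
    rw [MvPolynomial.pderiv_C_mul, MvPolynomial.pderiv_X_of_ne (by omega), mul_zero]
  pderiv_top := ⟨1 / 2, by norm_num, by simp⟩

lemma not_dvd_X_zero {f p : MvPolynomial ℕ ℂ} (hf : jetEval 2 f = 1) (hp : Prime p) (hpf : p ∣ f) :
    ¬p ∣ MvPolynomial.X 0 := by
  intro hpX
  have hXf := ((hp.associated_of_dvd MvPolynomial.X_prime hpX).dvd_iff_dvd_left).1 hpf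
  have h1 := map_dvd (jetEval 2) hXf
  rw [hf, jetEval_X_zero] at h1
  exact Polynomial.not_isUnit_X (isUnit_of_dvd_one h1)

lemma JetPair.isRelPrime_next {n : ℕ} {g f h : MvPolynomial ℕ ℂ} (H : JetPair n g f)
    (hgh : 2 * g * h = jetForm f) : IsRelPrime f h := by
  have hf0 : f ≠ 0 := by
    rintro rfl
    simpa using H.eval_right
  refine (UniqueFactorizationMonoid.isRelPrime_iff_no_prime_factors hf0).2 ?_
  intro p hpf hph hp
  have hX := not_dvd_X_zero H.eval_right hp hpf
  have hsq : p ∣ MvPolynomial.X 0 * jetDerivation f ^ 2 := by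
    have : MvPolynomial.X 0 * jetDerivation f ^ 2 = 2 * g * h -
        f * (MvPolynomial.X 1 * f - jetDerivation f
          - MvPolynomial.X 0 * jetDerivation (jetDerivation f)) := by
      rw [hgh, jetForm, umemuraForm]; ring
    rw [this]
    exact dvd_sub (hph.mul_left _) (hpf.mul_right _)
  obtain ⟨q, hq⟩ := hp.dvd_of_dvd_pow ((hp.dvd_or_dvd hsq).resolve_left hX)
  obtain ⟨c, hc, htop⟩ := H.pderiv_top
  have hf2 := H.pderiv_right (2 * n + 2) (by omega)
  have hpq := congrArg (MvPolynomial.pderiv (2 * n + 2)) hq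
  rw [pderiv_jetDerivation, hf2, map_zero, zero_add, htop, MvPolynomial.pderiv_mul,
    pderiv_eq_zero_of_dvd hf0 hpf hf2, zero_mul, zero_add] at hpq
  have hdvd : p ∣ MvPolynomial.C c * MvPolynomial.X 0 ^ n * g := ⟨_, hpq⟩
  rcases hp.dvd_or_dvd hdvd with hcX | hpg
  · rcases hp.dvd_or_dvd hcX with hpc | hpX
    · exact hp.not_isUnit (isUnit_of_dvd_unit hpc ((isUnit_iff_ne_zero.2 hc).map MvPolynomial.C))
    · exact hX (hp.dvd_of_dvd_pow hpX)
  · exact hp.not_isUnit (H.isRelPrime hpg hpf)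

lemma JetPair.exists_next {n : ℕ} {g f : MvPolynomial ℕ ℂ} (H : JetPair n g f) :
    ∃ h, 2 * g * h = jetForm f ∧ JetPair (n + 1) f h := by
  have hunit : MvPolynomial.C (1 / 2) * 2 = (1 : MvPolynomial ℕ ℂ) := by
    rw [← map_ofNat MvPolynomial.C 2, ← MvPolynomial.C_mul]
    norm_num
  obtain ⟨k, hk⟩ := H.dvd_right
  obtain ⟨h, hgh⟩ : ∃ h, 2 * g * h = jetForm f :=
    ⟨MvPolynomial.C (1 / 2) * k, by linear_combination g * k * hunit - hk⟩
  have hg0 : 2 * g ≠ 0 := by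
    refine mul_ne_zero two_ne_zero ?_
    rintro rfl
    simpa using H.eval_left
  have hzero : ∀ j, 2 * n < j → MvPolynomial.pderiv (j + 1) f = 0 →
      MvPolynomial.pderiv (j + 3) h = 0 := by
    intro j hj hjf
    have := pderiv_of_two_mul_mul_eq_jetForm hgh (H.pderiv_left (j + 3) (by omega))
      (H.pderiv_right (j + 2) (by omega)) (H.pderiv_right (j + 3) (by omega))
    rw [hjf, mul_zero, neg_zero] at this
    exact (mul_eq_zero.1 this).resolve_left hg0
  refine ⟨h, hgh, ?_, ?_, H.isRelPrime_next hgh, H.eval_right, ?_, ?_, ?_, ?_⟩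
  · exact ⟨2 * g, by rw [← hgh, mul_comm]⟩
  · have hdvd := dvd_mul_umemuraForm jetDerivation_X_zero hgh H.dvd_left
    have h4 : f ∣ g ^ 2 * jetForm h := by
      have := hdvd.mul_left (MvPolynomial.C (1 / 2) ^ 2)
      convert this using 1
      linear_combination (-(g ^ 2 * jetForm h)) * (MvPolynomial.C (1 / 2) * 2 + 1) * hunit
    exact (H.isRelPrime.symm.pow_right).dvd_of_dvd_mul_left h4
  · have := congrArg (jetEval 2) hgh
    rw [jetEval_two_jetForm H.eval_right, map_mul, map_mul, H.eval_left, map_ofNat, mul_one] at this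
    exact mul_left_cancel₀ two_ne_zero (this.trans (mul_one 2).symm)
  · exact fun j hj => H.pderiv_right j (by omega)
  · intro j hj
    obtain ⟨i, rfl⟩ : ∃ i, j = i + 3 := ⟨j - 3, by omega⟩
    exact hzero i (by omega) (H.pderiv_right _ (by omega))
  · obtain ⟨c, hc, htop⟩ := H.pderiv_top
    refine ⟨-(1 / 2 * c), by simpa using hc, ?_⟩
    have := pderiv_of_two_mul_mul_eq_jetForm (j := 2 * n) hgh (H.pderiv_left _ (by omega))
      (H.pderiv_right _ (by omega)) (H.pderiv_right _ (by omega))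
    rw [htop] at this
    apply mul_left_cancel₀ hg0
    rw [show 2 * (n + 1) + 1 = 2 * n + 3 by ring, this, MvPolynomial.C_neg, MvPolynomial.C_mul]
    linear_combination MvPolynomial.C c * MvPolynomial.X 0 ^ (n + 1) * g * f * hunit

/-- The generic Umemura sequence, started at index `0`. -/
lemma exists_jet_sequence : ∃ u : ℕ → MvPolynomial ℕ ℂ, u 0 = 1 ∧ 2 * u 1 = jetForm 1 ∧
    ∀ n, 2 * u n * u (n + 2) = jetForm (u (n + 1)) := by
  choose next hnext using @JetPair.exists_next
  let pairs : ∀ n, {q : MvPolynomial ℕ ℂ × MvPolynomial ℕ ℂ // JetPair n q.1 q.2} := fun n =>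
    Nat.rec ⟨(1, MvPolynomial.C (1 / 2) * MvPolynomial.X 1), JetPair.zero⟩
      (fun _ q => ⟨(q.1.2, next q.2), (hnext q.2).2⟩) n
  refine ⟨fun n => (pairs n).1.1, rfl, ?_, fun n => (hnext (pairs n).2).1⟩
  change 2 * (MvPolynomial.C (1 / 2) * MvPolynomial.X 1) = _
  rw [jetForm_one, ← map_ofNat MvPolynomial.C 2, ← mul_assoc, ← MvPolynomial.C_mul]
  norm_num

end Generic

lemma natDegree_X_mul_derivative_le (p : ℂ[X]) :
    (X * derivative p).natDegree ≤ p.natDegree := by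
  by_cases h : p.natDegree = 0
  · rw [derivative_of_natDegree_zero h, mul_zero, natDegree_zero]
    exact Nat.zero_le _
  · have := natDegree_derivative_lt h
    exact natDegree_mul_le.trans (by rw [natDegree_X]; omega)

lemma umemuraForm_derivative_ne_zero {a f : ℂ[X]} (ha : 0 < a.natDegree) (hf : f ≠ 0) :
    umemuraForm derivative' X a f ≠ 0 := by
  intro h
  have ha0 : a ≠ 0 := ne_zero_of_natDegree_gt ha
  have heq : a * f ^ 2 = f * (derivative f + X * derivative (derivative f))
      - derivative f * (X * derivative f) := by
    have h' : a * f ^ 2 - f * derivative f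
      - X * (f * derivative (derivative f) - derivative f ^ 2) = 0 := h
    linear_combination h'
  have hd := natDegree_derivative_le f
  have h1 := natDegree_X_mul_derivative_le f
  have h2 := natDegree_X_mul_derivative_le (derivative f)
  have h3 : (derivative f + X * derivative (derivative f)).natDegree ≤ f.natDegree :=
    natDegree_add_le_of_degree_le (hd.trans (Nat.sub_le _ _))
      (h2.trans (hd.trans (Nat.sub_le _ _)))
  have hle := natDegree_sub_le_of_le (natDegree_mul_le_of_le (le_refl f.natDegree) h3)
    (natDegree_mul_le_of_le (hd.trans (Nat.sub_le _ _)) h1)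
  rw [← heq, natDegree_mul ha0 (pow_ne_zero 2 hf), natDegree_pow] at hle
  rw [max_self] at hle
  omega

/-- For every `m ∈ ℂ` an Umemura polynomial sequence with parameter `m` exists;
in particular the right-hand side of the recurrence is always divisible by
`2·s_{n-1}`. -/
theorem umemura_sequence_exists (m : ℂ) :
    ∃ s : ℤ → Polynomial ℂ, IsUmemuraSeq m s := by
  obtain ⟨u, hu0, hu1, hu⟩ := exists_jet_sequence
  set a : ℂ[X] := 4 * X + C (2 * m + 1) with ha
  have hdeg : 0 < a.natDegree := by
    rw [ha, ← C_ofNat, natDegree_linear (by norm_num)]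
    exact one_pos
  set v : ℕ → ℂ[X] := fun n => jetEval a (u n) with hv
  have hv0 : v 0 = 1 := by rw [hv]; simp [hu0]
  have hv1 : 2 * v 1 = umemuraForm derivative' X a (v 0) := by
    have := congrArg (jetEval a) hu1
    rwa [jetEval_jetForm, map_mul, map_ofNat, map_one, ← hv0] at this
  have hvs : ∀ n, 2 * v n * v (n + 2) = umemuraForm derivative' X a (v (n + 1)) := by
    intro n
    have := congrArg (jetEval a) (hu n)
    rwa [jetEval_jetForm, map_mul, map_mul, map_ofNat] at this
  have hne : ∀ n, v n ≠ 0 := by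
    have hpair : ∀ n, v n ≠ 0 ∧ v (n + 1) ≠ 0 := by
      intro n
      induction n with
      | zero =>
        have h0 : v 0 ≠ 0 := by rw [hv0]; exact one_ne_zero
        exact ⟨h0, right_ne_zero_of_mul (hv1 ▸ umemuraForm_derivative_ne_zero hdeg h0)⟩
      | succ n ih =>
        exact ⟨ih.2, right_ne_zero_of_mul (hvs n ▸ umemuraForm_derivative_ne_zero hdeg ih.2)⟩
    exact fun n => (hpair n).1
  refine ⟨fun k => if k < 0 then 1 else v k.toNat, ?_, by simp, by simp [hv0], ?_⟩
  · intro k _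
    dsimp only
    split_ifs
    · exact one_ne_zero
    · exact hne _
  · intro k hk
    obtain ⟨n, rfl⟩ := Int.eq_ofNat_of_zero_le hk
    cases n with
    | zero => simpa [hv0, umemuraForm, ha] using hv1
    | succ n =>
      have e0 : ((n + 1 : ℕ) : ℤ) - 1 = (n : ℕ) := by push_cast; ring
      have e2 : ((n + 1 : ℕ) : ℤ) + 1 = (n + 2 : ℕ) := by push_cast; ring
      simp only [e0, e2, Int.toNat_natCast, Int.natCast_nonneg, not_lt.2, if_false]
      exact hvs n
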